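/- arXiv:2209.14050 — 4 statements merged into one kernel-verified Lean document; each statement's English description precedes it below -/
import Mathlib

section
/- Let K be a Hermitian positive definite k×k complex matrix, and let S1 = [1:k1], S2 = [k1+1:k2], S3 = [k2+1:k3], S4 = [k3+1:k] be a sequential partition of the index set {1,…,k}. Then det(K) · det(K(S2)) · det(K(S4)) ≤ det(K(S2 ∪ S4)) · det(K(S1 ∪ S2)) · det(K(S3 ∪ S4)), where K(S) denotes the principal submatrix of K on the rows and columns indexed by S (equivalently, det(K)/det(K(S2 ∪ S4)) ≤ [det(K(S1 ∪ S2))/det(K(S2))] · [det(K(S3 ∪ S4))/det(K(S4))]). -/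
open Matrix
open scoped ComplexOrder

/-- The principal submatrix of `K` on the rows and columns indexed by the finite set `S`. -/
noncomputable def principalSub {k : ℕ} (K : Matrix (Fin k) (Fin k) ℂ) (S : Finset (Fin k)) :
    Matrix S S ℂ :=
  K.submatrix (fun i => (i : Fin k)) (fun j => (j : Fin k))

namespace Matrix

theorem submatrix_sumElim {R m p α : Type*} (K : Matrix α α R) (i : m → α) (j : p → α) :
    K.submatrix (Sum.elim i j) (Sum.elim i j) =
      fromBlocks (K.submatrix i i) (K.submatrix i j) (K.submatrix j i) (K.submatrix j j) := by
  ext (a | a) (b | b) <;> rfl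

section BlockInequalities

variable {𝕜 m n p α : Type*} [RCLike 𝕜] [Fintype m] [DecidableEq m] [Fintype n] [DecidableEq n]
  [Fintype p] [DecidableEq p]

theorem PosSemidef.one_le_det_one_add {Q : Matrix n n 𝕜} (hQ : Q.PosSemidef) :
    1 ≤ (1 + Q).det := by
  have h : (1 + Q).det = ∏ i, (1 + (hQ.1.eigenvalues i : 𝕜)) := by
    conv_lhs => rw [hQ.1.spectral_theorem, Unitary.conjStarAlgAut_apply, mul_assoc,
      det_one_add_mul_comm, mul_assoc, Unitary.coe_star_mul_self, mul_one, ← diagonal_one,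
      diagonal_add, det_diagonal]
    simp
  rw [h]
  have h' : (1 : ℝ) ≤ ∏ i, (1 + hQ.1.eigenvalues i) :=
    Finset.one_le_prod fun i _ => by linarith [hQ.eigenvalues_nonneg i]
  exact_mod_cast h'

open scoped MatrixOrder in
theorem PosDef.det_le_det_add {X R : Matrix n n 𝕜} (hX : X.PosDef) (hR : R.PosSemidef) :
    X.det ≤ (X + R).det := by
  obtain ⟨B, rfl⟩ := CStarAlgebra.nonneg_iff_eq_star_mul_self.mp hR.nonneg
  have hdet : (X + star B * B).det = X.det * (1 + B * X⁻¹ * star B).det :=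
    det_add_mul _ _ ((isUnit_iff_isUnit_det X).1 hX.isUnit)
  rw [hdet]
  exact le_mul_of_one_le_right hX.det_pos.le
    (hX.inv.posSemidef.mul_mul_conjTranspose_same B).one_le_det_one_add

/-- The Schur complement of the block of `K` indexed by `j` in the block indexed by `i` and `j`. -/
noncomputable def schurComplement (K : Matrix α α 𝕜) (i : m → α) (j : p → α) : Matrix m m 𝕜 :=
  K.submatrix i i - K.submatrix i j * (K.submatrix j j)⁻¹ * K.submatrix j i

theorem PosDef.det_submatrix_sumElim {K : Matrix α α 𝕜} (hK : K.PosDef) (i : m → α) {j : p → α}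
    (hj : j.Injective) :
    (K.submatrix (Sum.elim i j) (Sum.elim i j)).det =
      (K.submatrix j j).det * (K.schurComplement i j).det := by
  have := (hK.submatrix hj).isUnit.invertible
  rw [submatrix_sumElim, det_fromBlocks₂₂, invOf_eq_nonsing_inv, schurComplement]

omit [DecidableEq m] in
theorem PosDef.posSemidef_schurComplement {K : Matrix α α 𝕜} (hK : K.PosDef) (i : m → α)
    {j : p → α} (hj : j.Injective) : (K.schurComplement i j).PosSemidef := by
  have := (hK.submatrix hj).isUnit.invertible
  have hC : K.submatrix j i = (K.submatrix i j)ᴴ := by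
    rw [conjTranspose_submatrix, hK.1.eq]
  have h := hK.posSemidef.submatrix (Sum.elim i j)
  rw [submatrix_sumElim, hC, PosDef.fromBlocks₂₂ _ _ (hK.submatrix hj)] at h
  rwa [schurComplement, hC]

theorem PosDef.posDef_schurComplement {K : Matrix α α 𝕜} (hK : K.PosDef) {i : m → α} {j : p → α}
    (hij : (Sum.elim i j).Injective) : (K.schurComplement i j).PosDef := by
  have hj : j.Injective := hij.comp Sum.inr_injective
  rw [(hK.posSemidef_schurComplement i hj).posDef_iff_det_ne_zero]
  have h := (hK.submatrix hij).det_pos.ne'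
  rw [hK.det_submatrix_sumElim i hj] at h
  exact right_ne_zero_of_mul h

/-- **Fischer's inequality**. -/
theorem PosDef.det_le_det_mul_det {M : Matrix (m ⊕ n) (m ⊕ n) 𝕜} (hM : M.PosDef) :
    M.det ≤ (M.submatrix Sum.inl Sum.inl).det * (M.submatrix Sum.inr Sum.inr).det := by
  have hinr := hM.submatrix (Sum.inr_injective (α := m) (β := n))
  have hinj : (Sum.elim Sum.inl Sum.inr : m ⊕ n → m ⊕ n).Injective := by
    rw [Sum.elim_inl_inr]; exact Function.injective_id
  have h := hM.det_submatrix_sumElim (Sum.inl : m → m ⊕ n) Sum.inr_injective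
  rw [Sum.elim_inl_inr, submatrix_id_id] at h
  have hR : (M.submatrix Sum.inl Sum.inr * (M.submatrix Sum.inr Sum.inr)⁻¹ *
      M.submatrix Sum.inr Sum.inl).PosSemidef := by
    have hC : M.submatrix Sum.inr Sum.inl = (M.submatrix Sum.inl Sum.inr)ᴴ := by
      rw [conjTranspose_submatrix, hM.1.eq]
    rw [hC]
    exact hinr.inv.posSemidef.mul_mul_conjTranspose_same _
  have hle := (hM.posDef_schurComplement hinj).det_le_det_add hR
  rw [schurComplement, sub_add_cancel] at hle
  rw [h, mul_comm]
  exact mul_le_mul_of_nonneg_right hle hinr.det_pos.le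

/-- **Koteljanskii's inequality**. -/
theorem PosDef.det_mul_det_le {K : Matrix α α 𝕜} (hK : K.PosDef) {a : m → α} {b : n → α}
    {c : p → α} (h : (Sum.elim (Sum.elim a b) c).Injective) :
    (K.submatrix (Sum.elim (Sum.elim a b) c) (Sum.elim (Sum.elim a b) c)).det *
        (K.submatrix c c).det ≤
      (K.submatrix (Sum.elim a c) (Sum.elim a c)).det *
        (K.submatrix (Sum.elim b c) (Sum.elim b c)).det := by
  have hc : c.Injective := h.comp Sum.inr_injective
  have hdet := (hK.submatrix hc).det_pos.le
  have key : (K.schurComplement (Sum.elim a b) c).det ≤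
      (K.schurComplement a c).det * (K.schurComplement b c).det :=
    (hK.posDef_schurComplement h).det_le_det_mul_det
  rw [hK.det_submatrix_sumElim _ hc, hK.det_submatrix_sumElim _ hc, hK.det_submatrix_sumElim _ hc]
  calc _ = (K.submatrix c c).det * (K.submatrix c c).det *
        (K.schurComplement (Sum.elim a b) c).det := by ring
    _ ≤ (K.submatrix c c).det * (K.submatrix c c).det *
        ((K.schurComplement a c).det * (K.schurComplement b c).det) :=
      mul_le_mul_of_nonneg_left key (mul_nonneg hdet hdet)
    _ = _ := by ring

end BlockInequalities

end Matrix

section PrincipalSub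

variable {k : ℕ} {K : Matrix (Fin k) (Fin k) ℂ}

theorem det_principalSub_pos (hK : K.PosDef) (S : Finset (Fin k)) : 0 < (principalSub K S).det :=
  (hK.submatrix Subtype.val_injective).det_pos

theorem det_principalSub_univ (K : Matrix (Fin k) (Fin k) ℂ) :
    (principalSub K Finset.univ).det = K.det :=
  det_submatrix_equiv_self (Equiv.subtypeUnivEquiv Finset.mem_univ) K

theorem det_principalSub_eq {ι : Type*} [Fintype ι] [DecidableEq ι] {f : ι → Fin k}
    (hf : f.Injective) {S : Finset (Fin k)} (hS : ∀ x, x ∈ S ↔ ∃ i, f i = x) :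
    (principalSub K S).det = (K.submatrix f f).det := by
  let e : ι ≃ S := Equiv.ofBijective (fun i => ⟨f i, (hS _).2 ⟨i, rfl⟩⟩)
    ⟨fun i j h => hf (congrArg Subtype.val h), fun x =>
      let ⟨i, hi⟩ := (hS x).1 x.2
      ⟨i, Subtype.ext hi⟩⟩
  exact (det_submatrix_equiv_self e (principalSub K S)).symm

/-- **Koteljanskii's inequality** for principal submatrices indexed by disjoint sets. -/
theorem det_principalSub_union_mul_le (hK : K.PosDef) {A B C : Finset (Fin k)}
    (hAB : Disjoint A B) (hAC : Disjoint A C) (hBC : Disjoint B C) :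
    (principalSub K (A ∪ B ∪ C)).det * (principalSub K C).det ≤
      (principalSub K (A ∪ C)).det * (principalSub K (B ∪ C)).det := by
  have hne {S T : Finset (Fin k)} (h : Disjoint S T) (i : S) (j : T) : (i : Fin k) ≠ j :=
    Finset.disjoint_iff_ne.1 h i i.2 j j.2
  have hAB' := Subtype.val_injective.sumElim Subtype.val_injective (hne hAB)
  have hAC' := Subtype.val_injective.sumElim Subtype.val_injective (hne hAC)
  have hBC' := Subtype.val_injective.sumElim Subtype.val_injective (hne hBC)
  have hABC := hAB'.sumElim (Subtype.val_injective (p := (· ∈ C))) (by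
    rintro (i | i) j
    exacts [hne hAC i j, hne hBC i j])
  rw [det_principalSub_eq (S := A ∪ B ∪ C) hABC (by simp [or_assoc]),
    det_principalSub_eq (S := A ∪ C) hAC' (by simp),
    det_principalSub_eq (S := B ∪ C) hBC' (by simp)]
  exact hK.det_mul_det_le hABC

end PrincipalSub

/-- **Fischer-like determinant inequality.**  For a Hermitian positive definite `k × k`
matrix `K` and a sequential partition `S1 = [1:k1]`, `S2 = [k1+1:k2]`, `S3 = [k2+1:k3]`,
`S4 = [k3+1:k]` of the index set, one has
`det K · det K(S2) · det K(S4) ≤ det K(S2 ∪ S4) · det K(S1 ∪ S2) · det K(S3 ∪ S4)`. -/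
theorem fischer_like_det_ineq (k k1 k2 k3 : ℕ)
    (h12 : k1 ≤ k2) (h23 : k2 ≤ k3) (h3k : k3 ≤ k)
    (K : Matrix (Fin k) (Fin k) ℂ) (hK : K.PosDef)
    (S1 S2 S3 S4 : Finset (Fin k))
    (hS1 : S1 = Finset.univ.filter fun i : Fin k => (i : ℕ) < k1)
    (hS2 : S2 = Finset.univ.filter fun i : Fin k => k1 ≤ (i : ℕ) ∧ (i : ℕ) < k2)
    (hS3 : S3 = Finset.univ.filter fun i : Fin k => k2 ≤ (i : ℕ) ∧ (i : ℕ) < k3)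
    (hS4 : S4 = Finset.univ.filter fun i : Fin k => k3 ≤ (i : ℕ)) :
    K.det * (principalSub K S2).det * (principalSub K S4).det ≤
      (principalSub K (S2 ∪ S4)).det * (principalSub K (S1 ∪ S2)).det *
        (principalSub K (S3 ∪ S4)).det := by
  have hd12 : Disjoint S1 S2 := by
    subst hS1 hS2; exact Finset.disjoint_filter.2 fun _ _ _ => by omega
  have hd13 : Disjoint S1 S3 := by
    subst hS1 hS3; exact Finset.disjoint_filter.2 fun _ _ _ => by omega
  have hd14 : Disjoint S1 S4 := by
    subst hS1 hS4; exact Finset.disjoint_filter.2 fun _ _ _ => by omega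
  have hd23 : Disjoint S2 S3 := by
    subst hS2 hS3; exact Finset.disjoint_filter.2 fun _ _ _ => by omega
  have hd24 : Disjoint S2 S4 := by
    subst hS2 hS4; exact Finset.disjoint_filter.2 fun _ _ _ => by omega
  have hd34 : Disjoint S3 S4 := by
    subst hS3 hS4; exact Finset.disjoint_filter.2 fun _ _ _ => by omega
  have huniv : S1 ∪ S3 ∪ (S2 ∪ S4) = Finset.univ := by
    subst hS1 hS2 hS3 hS4
    ext i
    simp only [Finset.mem_union, Finset.mem_filter, Finset.mem_univ, true_and, iff_true]
    omega
  have hfull := det_principalSub_union_mul_le hK hd13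
    (Finset.disjoint_union_right.2 ⟨hd12, hd14⟩) (Finset.disjoint_union_right.2 ⟨hd23.symm, hd34⟩)
  have hleft := det_principalSub_union_mul_le hK hd14 hd12 hd24.symm
  have hright := det_principalSub_union_mul_le hK hd23.symm hd34 hd24
  rw [huniv, det_principalSub_univ] at hfull
  rw [show S1 ∪ S4 ∪ S2 = S1 ∪ (S2 ∪ S4) by rw [Finset.union_assoc, Finset.union_comm S4],
    Finset.union_comm S4] at hleft
  rw [Finset.union_assoc] at hright
  have h2 := (det_principalSub_pos hK S2).le
  have h4 := (det_principalSub_pos hK S4).le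
  have h24 := det_principalSub_pos hK (S2 ∪ S4)
  have h12 := (det_principalSub_pos hK (S1 ∪ S2)).le
  have h234 := (det_principalSub_pos hK (S3 ∪ (S2 ∪ S4))).le
  refine le_of_mul_le_mul_right ?_ h24
  calc _ = K.det * (principalSub K (S2 ∪ S4)).det *
        ((principalSub K S2).det * (principalSub K S4).det) := by ring
    _ ≤ _ := mul_le_mul_of_nonneg_right hfull (mul_nonneg h2 h4)
    _ = ((principalSub K (S1 ∪ (S2 ∪ S4))).det * (principalSub K S2).det) *
        ((principalSub K (S3 ∪ (S2 ∪ S4))).det * (principalSub K S4).det) := by ring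
    _ ≤ _ := mul_le_mul hleft hright (mul_nonneg h234 h4) (mul_nonneg h12 h24.le)
    _ = _ := by ring
end

section
/- Let H_r ∈ ℂ^{n_r×n_t} and H_e ∈ ℂ^{n_e×n_t} satisfy the degradedness condition Δ := H_r^H H_r − H_e^H H_e ≻ 0 (positive definite). Let K be an n_t×n_t Hermitian positive semidefinite matrix and K̃ an n_t×n_t complex symmetric matrix such that the augmented covariance matrix K̲ = [[K, K̃],[K̃^*, K^*]] is positive semidefinite. Then (1/2)·log det(I_{2n_r} + H̲_r K̲ H̲_r^H) − (1/2)·log det(I_{2n_e} + H̲_e K̲ H̲_e^H) ≤ log det(I_{n_r} + H_r K H_r^H) − log det(I_{n_e} + H_e K H_e^H), where H̲_r = [[H_r, 0],[0, H_r^*]] and H̲_e = [[H_e, 0],[0, H_e^*]]. -/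
open Matrix
open scoped ComplexOrder

/-- Entrywise complex conjugate of a matrix. -/
def mconj {m n : Type*} (M : Matrix m n ℂ) : Matrix m n ℂ := M.map (starRingEnd ℂ)

/-- The augmented channel matrix `H̲ = [[H, 0], [0, H*]]`. -/
def augChannel {m n : ℕ} (H : Matrix (Fin m) (Fin n) ℂ) :
    Matrix (Fin m ⊕ Fin m) (Fin n ⊕ Fin n) ℂ :=
  Matrix.fromBlocks H 0 0 (mconj H)

/-- The augmented covariance matrix `K̲ = [[K, K̃], [K̃*, K*]]`. -/
def augCov {n : ℕ} (K Kt : Matrix (Fin n) (Fin n) ℂ) :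
    Matrix (Fin n ⊕ Fin n) (Fin n ⊕ Fin n) ℂ :=
  Matrix.fromBlocks K Kt (mconj Kt) (mconj K)

namespace Matrix

variable {m n : Type*} [Fintype m] [DecidableEq m] [Fintype n] [DecidableEq n]

open scoped MatrixOrder in
theorem PosSemidef.exists_eq_conjTranspose_mul_self {S : Matrix n n ℂ} (hS : S.PosSemidef) :
    ∃ R : Matrix n n ℂ, S = Rᴴ * R :=
  CStarAlgebra.nonneg_iff_eq_star_mul_self.1 (nonneg_iff_posSemidef.2 hS)

theorem PosSemidef.one_le_det_one_add_s2 {E : Matrix n n ℂ} (hE : E.PosSemidef) :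
    1 ≤ (1 + E).det := by
  have hU : star (hE.1.eigenvectorUnitary : Matrix n n ℂ) * hE.1.eigenvectorUnitary = 1 :=
    Unitary.coe_star_mul_self _
  have hdet : (1 + E).det = ∏ i, ((1 + hE.1.eigenvalues i : ℝ) : ℂ) := by
    conv_lhs => rw [hE.1.spectral_theorem, Unitary.conjStarAlgAut_apply]
    rw [det_one_add_mul_comm, ← Matrix.mul_assoc, hU, Matrix.one_mul, ← diagonal_one,
      diagonal_add, det_diagonal]
    simp
  rw [hdet, ← Complex.ofReal_prod, ← Complex.ofReal_one, Complex.real_le_real]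
  exact Finset.one_le_prod fun i _ ↦ le_add_of_nonneg_right (hE.eigenvalues_nonneg i)

/-- The determinant is monotone on positive semidefinite matrices. -/
theorem PosSemidef.det_le_det {X Y : Matrix n n ℂ} (hX : X.PosSemidef)
    (hXY : (Y - X).PosSemidef) : X.det ≤ Y.det := by
  have hY : Y.PosSemidef := by simpa using hX.add hXY
  by_cases h0 : X.det = 0
  · exact h0 ▸ hY.det_nonneg
  have hdet : IsUnit X.det := isUnit_iff_ne_zero.2 h0
  obtain ⟨R, hR⟩ := hX.inv.exists_eq_conjTranspose_mul_self
  have key : Y.det = X.det * (1 + R * (Y - X) * Rᴴ).det := by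
    rw [Matrix.mul_assoc, det_one_add_mul_comm, Matrix.mul_assoc, ← hR,
      det_one_add_mul_comm, ← det_mul, Matrix.mul_add, Matrix.mul_one,
      mul_nonsing_inv_cancel_left _ _ hdet]
    simp
  rw [key]
  exact le_mul_of_one_le_right hX.det_nonneg
    (hXY.mul_mul_conjTranspose_same R).one_le_det_one_add_s2

/-- The two Schur complements of a Hermitian block matrix with positive definite diagonal blocks
are simultaneously positive semidefinite. -/
theorem PosDef.schurComplement_comm {U : Matrix m m ℂ} {V : Matrix n n ℂ} (hU : U.PosDef)
    (hV : V.PosDef) (B : Matrix m n ℂ) :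
    (V - Bᴴ * U⁻¹ * B).PosSemidef ↔ (U - B * V⁻¹ * Bᴴ).PosSemidef := by
  have := hU.isUnit.invertible
  have := hV.isUnit.invertible
  rw [← hU.fromBlocks₁₁ B V, hV.fromBlocks₂₂ U B]

theorem PosSemidef.det_one_sub_mul_le {S U N₁ N₂ : Matrix n n ℂ} (hS : S.PosSemidef)
    (hU : U.PosDef) (hSU : (U⁻¹ - S).PosSemidef) (hN : (N₂ - N₁).PosSemidef)
    (hNU : (U - N₂).PosSemidef) : (1 - S * N₂).det ≤ (1 - S * N₁).det := by
  obtain ⟨R, rfl⟩ := hS.exists_eq_conjTranspose_mul_self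
  have hRU : (1 - R * U * Rᴴ).PosSemidef := by
    have h := (PosDef.schurComplement_comm PosDef.one hU.inv R).1 (by simpa using hSU)
    rwa [nonsing_inv_nonsing_inv _ ((isUnit_iff_isUnit_det _).1 hU.isUnit)] at h
  rw [Matrix.mul_assoc, det_one_sub_mul_comm, Matrix.mul_assoc Rᴴ, det_one_sub_mul_comm Rᴴ]
  refine PosSemidef.det_le_det ?_ ?_
  · convert hRU.add (hNU.mul_mul_conjTranspose_same R) using 1
    noncomm_ring
  · convert hN.mul_mul_conjTranspose_same R using 1
    noncomm_ring

theorem PosDef.det_one_sub_inv_mul_le {U : Matrix m m ℂ} {V : Matrix n n ℂ} (hU : U.PosDef)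
    (hV : V.PosDef) {Y : Matrix m n ℂ} (hY : (V - Yᴴ * U⁻¹ * Y).PosSemidef)
    {S : Matrix m m ℂ} {T : Matrix n n ℂ} (hT : T.PosSemidef)
    (hSU : (U⁻¹ - S).PosSemidef) (hTV : (V⁻¹ - T).PosSemidef) :
    (1 - U⁻¹ * (Y * V⁻¹ * Yᴴ)).det ≤ (1 - S * (Y * T * Yᴴ)).det := by
  have hassoc (S : Matrix m m ℂ) :
      (1 - S * (Y * T * Yᴴ)).det = (1 - T * (Yᴴ * S * Y)).det := by
    rw [Matrix.mul_assoc Y, ← Matrix.mul_assoc, det_one_sub_mul_comm]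
    simp only [Matrix.mul_assoc]
  have hleft : (1 - U⁻¹ * (Y * V⁻¹ * Yᴴ)).det ≤ (1 - U⁻¹ * (Y * T * Yᴴ)).det := by
    refine hU.inv.posSemidef.det_one_sub_mul_le hU (by simpa using PosSemidef.zero) ?_
      ((hU.schurComplement_comm hV Y).1 hY)
    simpa only [Matrix.mul_sub, Matrix.sub_mul] using hTV.mul_mul_conjTranspose_same Y
  refine hleft.trans ?_
  rw [hassoc, hassoc]
  refine hT.det_one_sub_mul_le hV hTV ?_ hY
  simpa only [Matrix.mul_sub, Matrix.sub_mul] using hSU.conjTranspose_mul_mul_same Y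

/-- Push-through form of the matrix inversion lemma. -/
theorem conjTranspose_mul_inv_mul_eq_inv {H : Matrix m n ℂ} {K : Matrix n n ℂ}
    (hA : (Hᴴ * H).PosDef) (hP : (1 + H * K * Hᴴ).PosDef) :
    Hᴴ * (1 + H * K * Hᴴ)⁻¹ * H = ((Hᴴ * H)⁻¹ + K)⁻¹ := by
  have hA' := (isUnit_iff_isUnit_det _).1 hA.isUnit
  have hP' := (isUnit_iff_isUnit_det _).1 hP.isUnit
  have h : H * ((Hᴴ * H)⁻¹ + K) = (1 + H * K * Hᴴ) * (H * (Hᴴ * H)⁻¹) := by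
    rw [Matrix.add_mul, Matrix.one_mul, Matrix.mul_add, Matrix.mul_assoc (H * K),
      ← Matrix.mul_assoc Hᴴ, mul_nonsing_inv _ hA', Matrix.mul_one]
  refine (inv_eq_left_inv ?_).symm
  rw [Matrix.mul_assoc, h, Matrix.mul_assoc, nonsing_inv_mul_cancel_left _ _ hP',
    ← Matrix.mul_assoc, mul_nonsing_inv _ hA']

theorem PosSemidef.inv_sub_conjTranspose_mul_inv_mul {A : Matrix n n ℂ} {H : Matrix m n ℂ}
    {K : Matrix n n ℂ} (hA : A.PosDef) (hHA : (A - Hᴴ * H).PosSemidef) (hK : K.PosSemidef) :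
    ((A⁻¹ + K)⁻¹ - Hᴴ * (1 + H * K * Hᴴ)⁻¹ * H).PosSemidef := by
  have hU : (A⁻¹ + K).PosDef := hA.inv.add_posSemidef hK
  have hP : (1 + H * K * Hᴴ).PosDef :=
    PosDef.one.add_posSemidef (hK.mul_mul_conjTranspose_same H)
  refine (hP.schurComplement_comm hU.inv H).2 ?_
  rw [nonsing_inv_nonsing_inv _ ((isUnit_iff_isUnit_det _).1 hU.isUnit)]
  have h := (PosDef.schurComplement_comm PosDef.one hA H).1 (by simpa using hHA)
  convert h using 1
  rw [Matrix.mul_add, Matrix.add_mul]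
  abel

end Matrix

theorem mconj_eq {m n : Type*} (M : Matrix m n ℂ) : mconj M = Mᴴᵀ := rfl

theorem augCov_eq {n : ℕ} {K Kt : Matrix (Fin n) (Fin n) ℂ} (hK : K.IsHermitian)
    (hKt : Ktᵀ = Kt) : augCov K Kt = fromBlocks K Kt Ktᴴ Kᵀ := by
  have hcomm : Ktᴴᵀ = Ktᵀᴴ := rfl
  rw [augCov, mconj_eq, mconj_eq, hK.eq, hcomm, hKt]

theorem det_one_add_augChannel_mul {m n : ℕ} (H : Matrix (Fin m) (Fin n) ℂ)
    {K Kt : Matrix (Fin n) (Fin n) ℂ} (hK : K.PosSemidef) (hKt : Ktᵀ = Kt) :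
    (1 + augChannel H * augCov K Kt * (augChannel H)ᴴ).det =
      (1 + H * K * Hᴴ).det ^ 2 *
        (1 - (Hᴴ * (1 + H * K * Hᴴ)⁻¹ * H) *
          (Kt * (Hᴴ * (1 + H * K * Hᴴ)⁻¹ * H)ᵀ * Ktᴴ)).det := by
  have hP : (1 + H * K * Hᴴ).PosDef :=
    PosDef.one.add_posSemidef (hK.mul_mul_conjTranspose_same H)
  have hblocks : 1 + augChannel H * augCov K Kt * (augChannel H)ᴴ =
      fromBlocks (1 + H * K * Hᴴ) (H * Kt * Hᵀ) (Hᴴᵀ * Ktᴴ * Hᴴ) (1 + H * K * Hᴴ)ᵀ := by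
    rw [augCov_eq hK.1 hKt, augChannel, mconj_eq, fromBlocks_conjTranspose,
      fromBlocks_multiply, fromBlocks_multiply, ← fromBlocks_one, fromBlocks_add]
    have hH : Hᴴᵀᴴ = Hᵀ := by ext; simp
    simp [hH, Matrix.transpose_mul, Matrix.mul_assoc]
  set P := 1 + H * K * Hᴴ
  have := hP.isUnit.invertible
  have hPT : IsUnit Pᵀ.det := (isUnit_iff_isUnit_det _).1 hP.transpose.isUnit
  have hfactor : Pᵀ - Hᴴᵀ * Ktᴴ * Hᴴ * P⁻¹ * (H * Kt * Hᵀ) =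
      Pᵀ * (1 - Pᵀ⁻¹ * Hᴴᵀ * (Ktᴴ * (Hᴴ * P⁻¹ * H) * Kt * Hᵀ)) := by
    rw [Matrix.mul_sub, Matrix.mul_one, Matrix.mul_assoc Pᵀ⁻¹,
      mul_nonsing_inv_cancel_left _ _ hPT]
    simp only [Matrix.mul_assoc]
  rw [hblocks, det_fromBlocks₁₁, invOf_eq_nonsing_inv, hfactor, det_mul, det_transpose,
    det_one_sub_mul_comm, ← mul_assoc, ← sq]
  congr 1
  have hST : (Hᴴ * P⁻¹ * H)ᵀ = Hᵀ * (Pᵀ⁻¹ * Hᴴᵀ) := by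
    rw [Matrix.transpose_mul, Matrix.transpose_mul, transpose_nonsing_inv]
  rw [← Matrix.mul_assoc (Hᴴ * P⁻¹ * H), det_one_sub_mul_comm _ Ktᴴ, hST]
  simp only [Matrix.mul_assoc]

theorem augCov_posSemidef_add {n : ℕ} {A K Kt : Matrix (Fin n) (Fin n) ℂ} (hA : A.PosSemidef)
    (hK : K.IsHermitian) (hKt : Ktᵀ = Kt) (haug : (augCov K Kt).PosSemidef) :
    (fromBlocks (A + K) Kt Ktᴴ (A + K)ᵀ).PosSemidef := by
  obtain ⟨R, rfl⟩ := hA.exists_eq_conjTranspose_mul_self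
  have h := posSemidef_conjTranspose_mul_self (fromBlocks R 0 0 Rᴴᵀ)
  rw [augCov_eq hK hKt] at haug
  have hR : Rᴴᵀᴴ = Rᵀ := by ext; simp
  simpa [fromBlocks_conjTranspose, fromBlocks_multiply, fromBlocks_add, hR,
    Matrix.transpose_mul] using h.add haug

/-- In a degraded complex MIMO wiretap channel, the secrecy rate of a general (possibly
improper) complex Gaussian signal with covariance `K` and pseudo-covariance `K̃` is at most
the secrecy rate of the proper Gaussian signal with the same covariance `K`. -/
theorem secrecy_rate_le_proper_of_degraded (nt nr ne : ℕ)
    (Hr : Matrix (Fin nr) (Fin nt) ℂ) (He : Matrix (Fin ne) (Fin nt) ℂ)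
    (hdeg : (Hrᴴ * Hr - Heᴴ * He).PosDef)
    (K Kt : Matrix (Fin nt) (Fin nt) ℂ)
    (hK : K.PosSemidef) (hKt : Ktᵀ = Kt)
    (haug : (augCov K Kt).PosSemidef) :
    (1 / 2) * Real.log ((1 + augChannel Hr * augCov K Kt * (augChannel Hr)ᴴ).det).re
      - (1 / 2) * Real.log ((1 + augChannel He * augCov K Kt * (augChannel He)ᴴ).det).re
    ≤ Real.log ((1 + Hr * K * Hrᴴ).det).re - Real.log ((1 + He * K * Heᴴ).det).re := by
  have hA : (Hrᴴ * Hr).PosDef := by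
    simpa using hdeg.add_posSemidef (posSemidef_conjTranspose_mul_self He)
  have hU : ((Hrᴴ * Hr)⁻¹ + K).PosDef := hA.inv.add_posSemidef hK
  have hPr : (1 + Hr * K * Hrᴴ).PosDef :=
    PosDef.one.add_posSemidef (hK.mul_mul_conjTranspose_same Hr)
  have hPe : (1 + He * K * Heᴴ).PosDef :=
    PosDef.one.add_posSemidef (hK.mul_mul_conjTranspose_same He)
  have hQr := (PosDef.one.add_posSemidef
    (haug.mul_mul_conjTranspose_same (augChannel Hr))).det_pos
  have hQe := (PosDef.one.add_posSemidef
    (haug.mul_mul_conjTranspose_same (augChannel He))).det_pos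
  have hSe := PosSemidef.inv_sub_conjTranspose_mul_inv_mul hA hdeg.posSemidef hK
  have hschur : (((Hrᴴ * Hr)⁻¹ + K)ᵀ - Ktᴴ * ((Hrᴴ * Hr)⁻¹ + K)⁻¹ * Kt).PosSemidef := by
    have := hU.isUnit.invertible
    exact (hU.fromBlocks₁₁ Kt _).1 (augCov_posSemidef_add hA.inv.posSemidef hK.1 hKt haug)
  have hF := hU.det_one_sub_inv_mul_le hU.transpose hschur
    (hPe.inv.posSemidef.conjTranspose_mul_mul_same He).transpose hSe
    (by simpa [transpose_nonsing_inv] using hSe.transpose)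
  rw [← transpose_nonsing_inv, ← conjTranspose_mul_inv_mul_eq_inv hA hPr] at hF
  rw [det_one_add_augChannel_mul _ hK hKt] at hQr hQe
  rw [det_one_add_augChannel_mul _ hK hKt, det_one_add_augChannel_mul _ hK hKt]
  have hlog {p f : ℂ} (hp : 0 < p) (hpf : 0 < p ^ 2 * f) :
      0 < f.re ∧ Real.log (p ^ 2 * f).re = 2 * Real.log p.re + Real.log f.re := by
    lift p to ℝ using (Complex.pos_iff.1 hp).2.symm
    rw [Complex.zero_lt_real] at hp
    have hre : ((p : ℂ) ^ 2 * f).re = p ^ 2 * f.re := by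
      rw [← Complex.ofReal_pow, Complex.re_ofReal_mul]
    have hf : 0 < f.re :=
      pos_of_mul_pos_right (hre ▸ (Complex.pos_iff.1 hpf).1) (sq_nonneg p)
    refine ⟨hf, ?_⟩
    rw [hre, Real.log_mul (pow_pos hp 2).ne' hf.ne', Real.log_pow]
    simp
  obtain ⟨hfr, hr⟩ := hlog hPr.det_pos hQr
  obtain ⟨-, he⟩ := hlog hPe.det_pos hQe
  rw [hr, he]
  linarith [Real.log_le_log hfr (Complex.le_def.1 hF).1]
end

section
/- Let H_r ∈ ℂ^{n_r×n_t}, H_e ∈ ℂ^{n_e×n_t} with Δ := H_r^H H_r − H_e^H H_e ≻ 0, and let P > 0. Define the general feasible set 𝒦̲_g of all augmented covariance matrices K̲ = [[K, K̃],[K̃^*, K^*]] ⪰ 0 with K Hermitian PSD, K̃ symmetric, and tr(K̲) ≤ 2P, and the proper feasible set 𝒦̲_p ⊆ 𝒦̲_g of those K̲ with K̃ = 0. Then the supremum over K̲ ∈ 𝒦̲_g of (1/2)·log det(I_{2n_t} + (Δ̲ + H̲_e^H H̲_e) K̲) − (1/2)·log det(I_{2n_e} + H̲_e K̲ H̲_e^H)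 equals the supremum of the same function over K̲ ∈ 𝒦̲_p, where Δ̲ = [[Δ, 0],[0, Δ^*]] and H̲_e = [[H_e, 0],[0, H_e^*]]. -/
open Matrix
open scoped ComplexOrder

/-- The general feasible set `𝒦̲_g`: augmented covariance matrices
`K̲ = [[K, K̃], [K̃*, K*]] ⪰ 0` with `K` Hermitian PSD, `K̃` symmetric, `tr(K̲) ≤ 2P`. -/
def feasibleGeneral (nt : ℕ) (P : ℝ) :
    Set (Matrix (Fin nt ⊕ Fin nt) (Fin nt ⊕ Fin nt) ℂ) :=
  {M | ∃ K Kt : Matrix (Fin nt) (Fin nt) ℂ, K.PosSemidef ∧ Ktᵀ = Kt ∧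
    M = Matrix.fromBlocks K Kt (mconj Kt) (mconj K) ∧ M.PosSemidef ∧ M.trace.re ≤ 2 * P}

/-- The proper feasible set `𝒦̲_p ⊆ 𝒦̲_g`: those augmented covariance matrices with `K̃ = 0`. -/
def feasibleProper (nt : ℕ) (P : ℝ) :
    Set (Matrix (Fin nt ⊕ Fin nt) (Fin nt ⊕ Fin nt) ℂ) :=
  {M | ∃ K : Matrix (Fin nt) (Fin nt) ℂ, K.PosSemidef ∧
    M = Matrix.fromBlocks K 0 0 (mconj K) ∧ M.PosSemidef ∧ M.trace.re ≤ 2 * P}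

open scoped MatrixOrder in
theorem Matrix.PosSemidef.exists_eq_conjTranspose_mul_self_s4 {n : Type*} [Fintype n] [DecidableEq n]
    {A : Matrix n n ℂ} (hA : A.PosSemidef) : ∃ S : Matrix n n ℂ, A = Sᴴ * S := by
  obtain ⟨S, hS⟩ := CStarAlgebra.nonneg_iff_eq_star_mul_self.mp hA.nonneg
  exact ⟨S, hS⟩

theorem Matrix.IsHermitian.det_smul_one_add_smul {n : Type*} [Fintype n] [DecidableEq n]
    {X : Matrix n n ℂ} (hX : X.IsHermitian) (a b : ℂ) :
    (a • (1 : Matrix n n ℂ) + b • X).det = ∏ i, (a + b * (hX.eigenvalues i : ℂ)) := by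
  let V : Matrix n n ℂ := (hX.eigenvectorUnitary : Matrix n n ℂ)
  let d : n → ℂ := fun i => (hX.eigenvalues i : ℂ)
  have hVV : V * star V = 1 := Unitary.coe_mul_star_self hX.eigenvectorUnitary
  have hX' : X = V * diagonal d * star V := by
    have h := hX.spectral_theorem
    rw [Unitary.conjStarAlgAut_apply] at h
    exact h
  have h : a • (1 : Matrix n n ℂ) + b • X = V * diagonal (fun i => a + b * d i) * star V := by
    have : diagonal (fun i => a + b * d i) = a • (1 : Matrix n n ℂ) + b • diagonal d := by
      ext i j
      by_cases hij : i = j <;> simp [hij, diagonal]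
    rw [this, Matrix.mul_add, Matrix.add_mul, Matrix.mul_smul, Matrix.smul_mul, Matrix.mul_one,
      hVV, Matrix.mul_smul, Matrix.smul_mul, ← hX']
  rw [h, det_mul_right_comm, hVV, Matrix.one_mul, det_diagonal]

/-- A positive definite and a positive semidefinite matrix are simultaneously congruent to the
identity and a positive semidefinite matrix. -/
theorem Matrix.PosDef.exists_mul_conjTranspose {n : Type*} [Fintype n] [DecidableEq n]
    {A B : Matrix n n ℂ} (hA : A.PosDef) (hB : B.PosSemidef) :
    ∃ C X : Matrix n n ℂ, X.PosSemidef ∧ A = C * Cᴴ ∧ B = C * X * Cᴴ := by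
  obtain ⟨S, hS⟩ := hA.posSemidef.exists_eq_conjTranspose_mul_self_s4
  have hu : IsUnit (Sᴴ * S) := hS ▸ hA.isUnit
  have hSd : IsUnit S.det := by
    rw [isUnit_iff_isUnit_det, det_mul] at hu
    exact isUnit_of_mul_isUnit_right hu
  have hSd' : IsUnit (Sᴴ).det := by
    rw [isUnit_iff_isUnit_det, det_mul] at hu
    exact isUnit_of_mul_isUnit_left hu
  refine ⟨Sᴴ, (S⁻¹)ᴴ * B * S⁻¹, hB.conjTranspose_mul_mul_same _, by simpa using hS, ?_⟩
  rw [conjTranspose_conjTranspose, conjTranspose_nonsing_inv]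
  simp only [Matrix.mul_assoc, nonsing_inv_mul _ hSd, Matrix.mul_one]
  rw [← Matrix.mul_assoc, mul_nonsing_inv _ hSd', Matrix.one_mul]

/-- The determinant is monotone above a positive definite matrix. -/
theorem Matrix.PosDef.det_le_det_add_s4 {n : Type*} [Fintype n] [DecidableEq n]
    {A B : Matrix n n ℂ} (hA : A.PosDef) (hB : B.PosSemidef) : A.det ≤ (A + B).det := by
  obtain ⟨C, X, hX, rfl, rfl⟩ := hA.exists_mul_conjTranspose hB
  have h : C * Cᴴ + C * X * Cᴴ = C * ((1 : ℂ) • (1 : Matrix n n ℂ) + (1 : ℂ) • X) * Cᴴ := by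
    simp [Matrix.mul_add, Matrix.add_mul]
  have h1 : (1 : ℂ) ≤ ∏ i, (1 + 1 * (hX.1.eigenvalues i : ℂ)) := by
    have : (1 : ℝ) ≤ ∏ i, (1 + hX.1.eigenvalues i) :=
      Finset.one_le_prod fun i _ => le_add_of_nonneg_right (hX.eigenvalues_nonneg i)
    simp only [one_mul]
    exact_mod_cast this
  rw [h, det_mul_right_comm, det_mul (C * Cᴴ), hX.1.det_smul_one_add_smul]
  exact le_mul_of_one_le_right hA.posSemidef.det_nonneg h1

/-- Midpoint log-concavity of the determinant. -/
theorem Matrix.PosDef.det_mul_det_le_det_midpoint_sq {n : Type*} [Fintype n] [DecidableEq n]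
    {A B : Matrix n n ℂ} (hA : A.PosDef) (hB : B.PosSemidef) :
    A.det * B.det ≤ ((1 / 2 : ℂ) • (A + B)).det ^ 2 := by
  obtain ⟨C, X, hX, rfl, rfl⟩ := hA.exists_mul_conjTranspose hB
  have h : (1 / 2 : ℂ) • (C * Cᴴ + C * X * Cᴴ) =
      C * ((1 / 2 : ℂ) • (1 : Matrix n n ℂ) + (1 / 2 : ℂ) • X) * Cᴴ := by
    simp [Matrix.mul_add, Matrix.add_mul]
  have h1 : X.det ≤ (∏ i, (1 / 2 + 1 / 2 * (hX.1.eigenvalues i : ℂ))) ^ 2 := by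
    have : ∏ i, hX.1.eigenvalues i ≤ (∏ i, (1 / 2 + 1 / 2 * hX.1.eigenvalues i)) ^ 2 := by
      rw [← Finset.prod_pow]
      refine Finset.prod_le_prod (fun i _ => hX.eigenvalues_nonneg i) fun i _ => ?_
      nlinarith [sq_nonneg (hX.1.eigenvalues i - 1)]
    rw [hX.1.det_eq_prod_eigenvalues]
    have h2 := Complex.real_le_real.mpr this
    push_cast at h2
    exact h2
  rw [h, det_mul_right_comm C X, det_mul_right_comm C _ Cᴴ, det_mul _ X, det_mul _ (_ + _),
    hX.1.det_smul_one_add_smul, mul_pow, ← mul_assoc, ← sq]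
  exact mul_le_mul_of_nonneg_left h1 (pow_nonneg hA.posSemidef.det_nonneg 2)

section ErrorCovariance

variable {m n : Type*} [Fintype m] [DecidableEq m] [Fintype n]

/-- The error covariance `M - M Eᴴ (1 + E M Eᴴ)⁻¹ E M` of the linear minimum mean square error
estimate of a vector with covariance `M` observed through `E` in unit white noise. -/
noncomputable def errorCov (E : Matrix m n ℂ) (M : Matrix n n ℂ) : Matrix n n ℂ :=
  M - M * Eᴴ * (1 + E * M * Eᴴ)⁻¹ * E * M

/-- The error covariance of the linear estimate with gain `Y`. -/
def linearErrorCov (E : Matrix m n ℂ) (Y : Matrix n m ℂ) (M : Matrix n n ℂ) : Matrix n n ℂ :=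
  M - Y * E * M - M * Eᴴ * Yᴴ + Y * (1 + E * M * Eᴴ) * Yᴴ

theorem posDef_one_add_mul_mul_conjTranspose (E : Matrix m n ℂ) {M : Matrix n n ℂ}
    (hM : M.PosSemidef) : (1 + E * M * Eᴴ).PosDef :=
  PosDef.one.add_posSemidef (hM.mul_mul_conjTranspose_same E)

theorem linearErrorCov_eq (E : Matrix m n ℂ) (Y : Matrix n m ℂ) {M : Matrix n n ℂ}
    (hM : M.PosSemidef) :
    linearErrorCov E Y M = errorCov E M + (Y - M * Eᴴ * (1 + E * M * Eᴴ)⁻¹) * (1 + E * M * Eᴴ) *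
      (Y - M * Eᴴ * (1 + E * M * Eᴴ)⁻¹)ᴴ := by
  have hN := posDef_one_add_mul_mul_conjTranspose E hM
  have hu := (isUnit_iff_isUnit_det _).mp hN.isUnit
  have hNi : ((1 + E * M * Eᴴ)⁻¹)ᴴ = (1 + E * M * Eᴴ)⁻¹ := hN.inv.isHermitian
  unfold linearErrorCov errorCov
  generalize 1 + E * M * Eᴴ = N at *
  rw [conjTranspose_sub, conjTranspose_mul, conjTranspose_mul, conjTranspose_conjTranspose, hNi,
    hM.1.eq]
  have h1 : (Y - M * Eᴴ * N⁻¹) * N = Y * N - M * Eᴴ := by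
    rw [Matrix.sub_mul, Matrix.mul_assoc _ N⁻¹, nonsing_inv_mul _ hu, Matrix.mul_one]
  have h2 : Y * N * (N⁻¹ * (E * M)) = Y * E * M := by
    rw [Matrix.mul_assoc Y, ← Matrix.mul_assoc N, mul_nonsing_inv _ hu, Matrix.one_mul,
      Matrix.mul_assoc]
  rw [h1, Matrix.sub_mul, Matrix.mul_sub, Matrix.mul_sub, h2]
  simp only [Matrix.mul_assoc]
  abel

theorem linearErrorCov_midpoint (E : Matrix m n ℂ) (Y : Matrix n m ℂ) (M₁ M₂ : Matrix n n ℂ) :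
    linearErrorCov E Y ((1 / 2 : ℂ) • (M₁ + M₂)) =
      (1 / 2 : ℂ) • (linearErrorCov E Y M₁ + linearErrorCov E Y M₂) := by
  unfold linearErrorCov
  simp only [Matrix.mul_add, Matrix.add_mul, Matrix.mul_smul, Matrix.smul_mul, Matrix.mul_one]
  module

theorem posSemidef_linearErrorCov_sub (E : Matrix m n ℂ) (Y : Matrix n m ℂ) {M : Matrix n n ℂ}
    (hM : M.PosSemidef) : (linearErrorCov E Y M - errorCov E M).PosSemidef := by
  rw [linearErrorCov_eq E Y hM, add_sub_cancel_left]
  exact (posDef_one_add_mul_mul_conjTranspose E hM).posSemidef.mul_mul_conjTranspose_same _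

theorem errorCov_eq_linearErrorCov (E : Matrix m n ℂ) {M : Matrix n n ℂ} (hM : M.PosSemidef) :
    errorCov E M = linearErrorCov E (M * Eᴴ * (1 + E * M * Eᴴ)⁻¹) M := by
  rw [linearErrorCov_eq E _ hM, sub_self, Matrix.zero_mul, Matrix.zero_mul, add_zero]

/-- Midpoint operator concavity of the error covariance. -/
theorem posSemidef_errorCov_midpoint_sub (E : Matrix m n ℂ) {M₁ M₂ : Matrix n n ℂ}
    (h₁ : M₁.PosSemidef) (h₂ : M₂.PosSemidef) :
    (errorCov E ((1 / 2 : ℂ) • (M₁ + M₂)) -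
      (1 / 2 : ℂ) • (errorCov E M₁ + errorCov E M₂)).PosSemidef := by
  have h : ((1 / 2 : ℂ) • (M₁ + M₂)).PosSemidef := (h₁.add h₂).smul (by positivity)
  rw [errorCov_eq_linearErrorCov E h, linearErrorCov_midpoint, ← smul_sub, add_sub_add_comm]
  exact ((posSemidef_linearErrorCov_sub E _ h₁).add (posSemidef_linearErrorCov_sub E _ h₂)).smul
    (by positivity)

variable [DecidableEq n]

theorem errorCov_mul_one_add (E : Matrix m n ℂ) {M : Matrix n n ℂ} (hM : M.PosSemidef) :
    errorCov E M * (1 + Eᴴ * E * M) = M := by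
  have hu := (isUnit_iff_isUnit_det _).mp (posDef_one_add_mul_mul_conjTranspose E hM).isUnit
  have h : (1 + E * M * Eᴴ)⁻¹ * E * M * (1 + Eᴴ * E * M) = E * M := by
    have : E * M * (1 + Eᴴ * E * M) = (1 + E * M * Eᴴ) * (E * M) := by
      simp only [Matrix.mul_add, Matrix.add_mul, Matrix.mul_one, Matrix.one_mul, Matrix.mul_assoc]
    rw [Matrix.mul_assoc _ E, Matrix.mul_assoc _ (E * M), this, ← Matrix.mul_assoc,
      nonsing_inv_mul _ hu, Matrix.one_mul]
  have h' : M * Eᴴ * (1 + E * M * Eᴴ)⁻¹ * E * M * (1 + Eᴴ * E * M) = M * Eᴴ * (E * M) := by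
    have := congrArg (fun T => M * Eᴴ * T) h
    simpa only [Matrix.mul_assoc] using this
  rw [errorCov, Matrix.sub_mul, h', Matrix.mul_add, Matrix.mul_one]
  simp only [Matrix.mul_assoc, add_sub_cancel_right]

theorem posSemidef_linearErrorCov (E : Matrix m n ℂ) (Y : Matrix n m ℂ) {M : Matrix n n ℂ}
    (hM : M.PosSemidef) : (linearErrorCov E Y M).PosSemidef := by
  have h : linearErrorCov E Y M = (1 - Y * E) * M * (1 - Y * E)ᴴ + Y * Yᴴ := by
    simp only [linearErrorCov, conjTranspose_sub, conjTranspose_one, conjTranspose_mul,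
      Matrix.mul_add, Matrix.add_mul, Matrix.mul_sub, Matrix.sub_mul, Matrix.mul_one,
      Matrix.one_mul, Matrix.mul_assoc]
    abel
  rw [h]
  exact (hM.mul_mul_conjTranspose_same _).add (posSemidef_self_mul_conjTranspose _)

theorem posSemidef_errorCov (E : Matrix m n ℂ) {M : Matrix n n ℂ} (hM : M.PosSemidef) :
    (errorCov E M).PosSemidef := by
  rw [errorCov_eq_linearErrorCov E hM]
  exact posSemidef_linearErrorCov E _ hM

theorem det_one_add_add_mul (S : Matrix n n ℂ) (E : Matrix m n ℂ) {M : Matrix n n ℂ}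
    (hM : M.PosSemidef) :
    (1 + (Sᴴ * S + Eᴴ * E) * M).det =
      (1 + S * errorCov E M * Sᴴ).det * (1 + E * M * Eᴴ).det := by
  have h : 1 + (Sᴴ * S + Eᴴ * E) * M = (1 + Sᴴ * (S * errorCov E M)) * (1 + Eᴴ * (E * M)) := by
    conv_lhs => rw [Matrix.add_mul, Matrix.mul_assoc _ S]
    conv_lhs => enter [2, 1]; rw [← errorCov_mul_one_add E hM]
    simp only [Matrix.mul_add, Matrix.add_mul, Matrix.mul_one, Matrix.one_mul, Matrix.mul_assoc]
    abel
  rw [h, det_mul, det_one_add_mul_comm, det_one_add_mul_comm Eᴴ]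

/-- Midpoint concavity of `log det (1 + (D + Eᴴ E) M) - log det (1 + E M Eᴴ)` in `M`,
in multiplicative form. -/
theorem det_ratio_midpoint_log_concave {D : Matrix n n ℂ} (hD : D.PosSemidef) (E : Matrix m n ℂ)
    {M₁ M₂ : Matrix n n ℂ} (h₁ : M₁.PosSemidef) (h₂ : M₂.PosSemidef) :
    (1 + (D + Eᴴ * E) * M₁).det * (1 + (D + Eᴴ * E) * M₂).det *
        (1 + E * ((1 / 2 : ℂ) • (M₁ + M₂)) * Eᴴ).det ^ 2 ≤
      (1 + (D + Eᴴ * E) * ((1 / 2 : ℂ) • (M₁ + M₂))).det ^ 2 *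
        ((1 + E * M₁ * Eᴴ).det * (1 + E * M₂ * Eᴴ).det) := by
  obtain ⟨S, rfl⟩ := hD.exists_eq_conjTranspose_mul_self_s4
  have hc := posSemidef_errorCov_midpoint_sub E h₁ h₂
  have h : ((1 / 2 : ℂ) • (M₁ + M₂)).PosSemidef := (h₁.add h₂).smul (by positivity)
  rw [det_one_add_add_mul S E h₁, det_one_add_add_mul S E h₂, det_one_add_add_mul S E h]
  generalize (1 / 2 : ℂ) • (M₁ + M₂) = M at *
  have hp₁ := posDef_one_add_mul_mul_conjTranspose S (posSemidef_errorCov E h₁)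
  have hp₂ := posDef_one_add_mul_mul_conjTranspose S (posSemidef_errorCov E h₂)
  have hN₁ := (posDef_one_add_mul_mul_conjTranspose E h₁).det_pos.le
  have hN₂ := (posDef_one_add_mul_mul_conjTranspose E h₂).det_pos.le
  have hN := (posDef_one_add_mul_mul_conjTranspose E h).det_pos.le
  have hmid : ((1 / 2 : ℂ) •
      ((1 + S * errorCov E M₁ * Sᴴ) + (1 + S * errorCov E M₂ * Sᴴ))).PosDef :=
    (hp₁.add hp₂).smul (by positivity)
  have hle : ((1 / 2 : ℂ) •
      ((1 + S * errorCov E M₁ * Sᴴ) + (1 + S * errorCov E M₂ * Sᴴ))).det ≤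
        (1 + S * errorCov E M * Sᴴ).det := by
    have h3 := hmid.det_le_det_add_s4 (hc.mul_mul_conjTranspose_same S)
    convert h3 using 2
    simp only [Matrix.mul_add, Matrix.add_mul, Matrix.mul_sub, Matrix.sub_mul, Matrix.mul_smul,
      Matrix.smul_mul]
    module
  have key : (1 + S * errorCov E M₁ * Sᴴ).det * (1 + S * errorCov E M₂ * Sᴴ).det ≤
      (1 + S * errorCov E M * Sᴴ).det ^ 2 :=
    (hp₁.det_mul_det_le_det_midpoint_sq hp₂.posSemidef).trans
      (pow_le_pow_left₀ hmid.det_pos.le hle 2)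
  have := mul_le_mul_of_nonneg_right key
    (mul_nonneg (mul_nonneg hN₁ hN₂) (pow_nonneg hN 2))
  convert this using 1 <;> ring

end ErrorCovariance

section Augmented

theorem mconj_mul {l m n : Type*} [Fintype m] (A : Matrix l m ℂ) (B : Matrix m n ℂ) :
    mconj (A * B) = mconj A * mconj B :=
  Matrix.map_mul

theorem mconj_conjTranspose {m n : Type*} (A : Matrix m n ℂ) : (mconj A)ᴴ = mconj Aᴴ := rfl

theorem Matrix.PosSemidef.mconj {n : Type*} {A : Matrix n n ℂ} (hA : A.PosSemidef) :
    (mconj A).PosSemidef := by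
  have h : _root_.mconj A = Aᵀ := by
    conv_rhs => rw [← hA.1.eq]
    ext i j
    simp [_root_.mconj]
  exact h ▸ hA.transpose

theorem Matrix.PosSemidef.fromBlocks_zero {m n : Type*} [Fintype m] [Fintype n]
    {A : Matrix m m ℂ} {B : Matrix n n ℂ} (hA : A.PosSemidef) (hB : B.PosSemidef) :
    (fromBlocks A 0 0 B).PosSemidef := by
  classical
  obtain ⟨S, rfl⟩ := hA.exists_eq_conjTranspose_mul_self_s4
  obtain ⟨T, rfl⟩ := hB.exists_eq_conjTranspose_mul_self_s4
  have := posSemidef_conjTranspose_mul_self (fromBlocks S 0 0 T)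
  simpa [fromBlocks_conjTranspose, fromBlocks_multiply] using this

theorem conjTranspose_augChannel_mul_self {m n : ℕ} (H : Matrix (Fin m) (Fin n) ℂ) :
    (augChannel H)ᴴ * augChannel H = fromBlocks (Hᴴ * H) 0 0 (mconj (Hᴴ * H)) := by
  simp [augChannel, fromBlocks_conjTranspose, fromBlocks_multiply, mconj_mul, mconj_conjTranspose]

/-- Flipping the sign of the off-diagonal blocks of `M` does not change `det (1 + A M)` when `A`
is block diagonal. -/
theorem det_one_add_fromBlocks_mul_neg {m n : Type*} [Fintype m] [DecidableEq m] [Fintype n]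
    [DecidableEq n] (A K : Matrix m m ℂ) (B L : Matrix n n ℂ) (X : Matrix m n ℂ)
    (Y : Matrix n m ℂ) :
    (1 + fromBlocks A 0 0 B * fromBlocks K (-X) (-Y) L).det =
      (1 + fromBlocks A 0 0 B * fromBlocks K X Y L).det := by
  have hU : (fromBlocks 1 0 0 (-1) : Matrix (m ⊕ n) (m ⊕ n) ℂ) * fromBlocks 1 0 0 (-1) = 1 := by
    simp [fromBlocks_multiply]
  have h : 1 + fromBlocks A 0 0 B * fromBlocks K (-X) (-Y) L =
      fromBlocks 1 0 0 (-1) * (1 + fromBlocks A 0 0 B * fromBlocks K X Y L) *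
        fromBlocks 1 0 0 (-1) := by
    rw [Matrix.mul_add, Matrix.add_mul, Matrix.mul_one, hU]
    simp [fromBlocks_multiply]
  rw [h, det_mul_right_comm, hU, Matrix.one_mul]

theorem Matrix.PosSemidef.fromBlocks_neg {m n : Type*} [Fintype m] [Fintype n]
    {K : Matrix m m ℂ} {L : Matrix n n ℂ} {X : Matrix m n ℂ} {Y : Matrix n m ℂ}
    (h : (fromBlocks K X Y L).PosSemidef) : (fromBlocks K (-X) (-Y) L).PosSemidef := by
  classical
  have := h.mul_mul_conjTranspose_same (fromBlocks 1 0 0 (-1) : Matrix (m ⊕ n) (m ⊕ n) ℂ)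
  simpa [fromBlocks_multiply, fromBlocks_conjTranspose] using this

end Augmented

/-- In a degraded complex MIMO wiretap channel, the supremum of the secrecy rate
`(1/2)·log det(I + (Δ̲ + H̲ₑᴴH̲ₑ)K̲) − (1/2)·log det(I + H̲ₑK̲H̲ₑᴴ)` over all augmented
covariance matrices with trace at most `2P` equals the supremum over the proper ones. -/
theorem degraded_sup_general_eq_sup_proper (nt nr ne : ℕ)
    (Hr : Matrix (Fin nr) (Fin nt) ℂ) (He : Matrix (Fin ne) (Fin nt) ℂ)
    (hdeg : (Hrᴴ * Hr - Heᴴ * He).PosDef)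
    (P : ℝ) (hP : 0 < P) :
    sSup ((fun M : Matrix (Fin nt ⊕ Fin nt) (Fin nt ⊕ Fin nt) ℂ =>
        (1 / 2) * Real.log ((1 +
          (Matrix.fromBlocks (Hrᴴ * Hr - Heᴴ * He) 0 0 (mconj (Hrᴴ * Hr - Heᴴ * He))
            + (augChannel He)ᴴ * augChannel He) * M).det).re
        - (1 / 2) * Real.log ((1 + augChannel He * M * (augChannel He)ᴴ).det).re) ''
      feasibleGeneral nt P)
    = sSup ((fun M : Matrix (Fin nt ⊕ Fin nt) (Fin nt ⊕ Fin nt) ℂ =>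
        (1 / 2) * Real.log ((1 +
          (Matrix.fromBlocks (Hrᴴ * Hr - Heᴴ * He) 0 0 (mconj (Hrᴴ * Hr - Heᴴ * He))
            + (augChannel He)ᴴ * augChannel He) * M).det).re
        - (1 / 2) * Real.log ((1 + augChannel He * M * (augChannel He)ᴴ).det).re) ''
      feasibleProper nt P) := by
  have hA : fromBlocks (Hrᴴ * Hr - Heᴴ * He) 0 0 (mconj (Hrᴴ * Hr - Heᴴ * He)) +
      (augChannel He)ᴴ * augChannel He = (augChannel Hr)ᴴ * augChannel Hr := by
    simp only [conjTranspose_augChannel_mul_self, fromBlocks_add, add_zero]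
    congr 1
    · abel
    · have h : ∀ A B : Matrix (Fin nt) (Fin nt) ℂ, mconj (A - B) + mconj B = mconj A := by
        intro A B
        ext i j
        simp [mconj]
      exact h _ _
  have hD : (fromBlocks (Hrᴴ * Hr - Heᴴ * He) 0 0
      (mconj (Hrᴴ * Hr - Heᴴ * He))).PosSemidef :=
    hdeg.posSemidef.fromBlocks_zero hdeg.posSemidef.mconj
  apply csSup_eq_csSup_of_forall_exists_le
  · rintro _ ⟨M, ⟨K, Kt, hK, -, rfl, hM, hT⟩, rfl⟩
    have hM' : (fromBlocks K 0 0 (mconj K)).PosSemidef := hK.fromBlocks_zero hK.mconj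
    refine ⟨_, ⟨fromBlocks K 0 0 (mconj K), ⟨K, hK, rfl, hM', ?_⟩, rfl⟩, ?_⟩
    · simpa [trace, Fintype.sum_sum_type] using hT
    have hmid : (1 / 2 : ℂ) • (fromBlocks K Kt (mconj Kt) (mconj K) +
        fromBlocks K (-Kt) (-mconj Kt) (mconj K)) = fromBlocks K 0 0 (mconj K) := by
      rw [fromBlocks_add, fromBlocks_smul, add_neg_cancel, add_neg_cancel]
      congr 1
      · module
      · simp
      · simp
      · module
    have key := det_ratio_midpoint_log_concave hD (augChannel He) hM hM.fromBlocks_neg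
    have hflip : ∀ {k : ℕ} (H : Matrix (Fin k) (Fin nt) ℂ),
        (1 + augChannel H * fromBlocks K (-Kt) (-mconj Kt) (mconj K) * (augChannel H)ᴴ).det =
          (1 + augChannel H * fromBlocks K Kt (mconj Kt) (mconj K) * (augChannel H)ᴴ).det := by
      intro k H
      rw [det_one_add_mul_comm, det_one_add_mul_comm _ (augChannel H)ᴴ, ← Matrix.mul_assoc,
        ← Matrix.mul_assoc, conjTranspose_augChannel_mul_self, det_one_add_fromBlocks_mul_neg]
    have hr : ∀ M, (1 + (augChannel Hr)ᴴ * augChannel Hr * M).det =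
        (1 + augChannel Hr * M * (augChannel Hr)ᴴ).det := by
      intro M
      rw [Matrix.mul_assoc, det_one_add_mul_comm]
    rw [hmid, hA] at key
    simp only [hA]
    simp only [hr, hflip] at key ⊢
    have hpos : ∀ {k : ℕ} (H : Matrix (Fin k) (Fin nt) ℂ)
        {M : Matrix (Fin nt ⊕ Fin nt) (Fin nt ⊕ Fin nt) ℂ}, M.PosSemidef →
        ∃ r : ℝ, 0 < r ∧ (1 + augChannel H * M * (augChannel H)ᴴ).det = (r : ℂ) := by
      intro k H M h
      have := (posDef_one_add_mul_mul_conjTranspose (augChannel H) h).det_pos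
      obtain ⟨h1, h2⟩ := Complex.pos_iff.mp this
      exact ⟨_, h1, Complex.ext rfl (by simpa using h2.symm)⟩
    obtain ⟨a, ha, ha'⟩ := hpos Hr hM
    obtain ⟨b, hb, hb'⟩ := hpos He hM
    obtain ⟨c, hc, hc'⟩ := hpos Hr hM'
    obtain ⟨d, hd, hd'⟩ := hpos He hM'
    rw [ha', hb', hc', hd'] at key ⊢
    have key' : (a * d) ^ 2 ≤ (c * b) ^ 2 := by
      have : a * a * d ^ 2 ≤ c ^ 2 * (b * b) := by exact_mod_cast key
      linarith
    have hlog := Real.log_le_log (by positivity)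
      ((sq_le_sq₀ (by positivity) (by positivity)).mp key')
    rw [Real.log_mul ha.ne' hd.ne', Real.log_mul hc.ne' hb.ne'] at hlog
    simp only [Complex.ofReal_re]
    linarith
  · rintro _ ⟨M, ⟨K, hK, rfl, hM, hT⟩, rfl⟩
    refine ⟨_, ⟨_, ⟨K, 0, hK, transpose_zero, ?_, hM, hT⟩, rfl⟩, le_rfl⟩
    simp [mconj]
end

section
/- Let H ∈ ℂ^{m×n}, let K be an n×n Hermitian positive semidefinite matrix, let K̃ be an n×n complex symmetric matrix with K̲ = [[K, K̃],[K̃^*, K^*]] ⪰ 0, and set H̲ = [[H, 0],[0, H^*]]. Let M_k = [[I_k, i·I_k],[I_k, −i·I_k]] ∈ ℂ^{2k×2k}, which satisfies M_k M_k^H = M_k^H M_k = 2·I_{2k}. Define the real-composite matrices K̄ = (1/4)·M_n^H K̲ M_n and H̄ = (√2/2)·M_m^H H̲ M_n. Then K̄ and H̄ have real entries, K̄ is symmetric positive semidefinite with tr(K̄) = tr(K), and det(I_{2m} + H̄ K̄ H̄^T) = det(I_{2m} + H̲ K̲ H̲^H). -/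
open Matrix
open scoped ComplexOrder

/-- The unitary-up-to-factor-2 matrix `M_k = [[I, i·I], [I, −i·I]]`. -/
noncomputable def Mmat (k : ℕ) : Matrix (Fin k ⊕ Fin k) (Fin k ⊕ Fin k) ℂ :=
  Matrix.fromBlocks 1 (Complex.I • 1) 1 (-(Complex.I • (1 : Matrix (Fin k) (Fin k) ℂ)))

theorem Mmat_conjTranspose (k : ℕ) :
    (Mmat k)ᴴ = fromBlocks 1 1 (-(Complex.I • 1)) (Complex.I • (1 : Matrix (Fin k) (Fin k) ℂ)) := by
  simp [Mmat, fromBlocks_conjTranspose, conjTranspose_smul]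

theorem Mmat_mul_conjTranspose (k : ℕ) : Mmat k * (Mmat k)ᴴ = (2 : ℂ) • 1 := by
  rw [Mmat_conjTranspose, Mmat, fromBlocks_multiply, ← fromBlocks_one, fromBlocks_smul]
  congr 1 <;> simp [smul_smul, two_smul]

theorem Mmat_conjTranspose_mul (k : ℕ) : (Mmat k)ᴴ * Mmat k = (2 : ℂ) • 1 := by
  rw [Mmat_conjTranspose, Mmat, fromBlocks_multiply, ← fromBlocks_one, fromBlocks_smul]
  congr 1 <;> simp [smul_smul, two_smul]

/-- Conjugating an augmented block matrix by `M` yields real entries. -/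
theorem im_Mmat_conjTranspose_mul_mul {m n : ℕ} (A B : Matrix (Fin m) (Fin n) ℂ)
    (i : Fin m ⊕ Fin m) (j : Fin n ⊕ Fin n) :
    (((Mmat m)ᴴ * fromBlocks A B (mconj B) (mconj A) * Mmat n) i j).im = 0 := by
  rw [Mmat_conjTranspose, Mmat, fromBlocks_multiply, fromBlocks_multiply]
  rcases i with i | i <;> rcases j with j | j <;>
    simp [mconj] <;> ring

theorem conjTranspose_eq_transpose_of_im_eq_zero {m n : Type*} {M : Matrix m n ℂ}
    (h : ∀ i j, (M i j).im = 0) : Mᴴ = Mᵀ := by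
  ext i j
  exact Complex.conj_eq_iff_im.mpr (h j i)

/-- The real-composite covariance `K̄ = (1/4)·M_nᴴ K̲ M_n` and channel
`H̄ = (√2/2)·M_mᴴ H̲ M_n` obtained from the augmented matrices via
`M_k = [[I, i·I],[I, −i·I]]` (which satisfies `M_k M_kᴴ = M_kᴴ M_k = 2·I`) have real
entries, `K̄` is symmetric positive semidefinite with `tr(K̄) = tr(K)`, and
`det(I + H̄ K̄ H̄ᵀ) = det(I + H̲ K̲ H̲ᴴ)`. -/
theorem real_composite_representation (m n : ℕ)
    (H : Matrix (Fin m) (Fin n) ℂ)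
    (K Kt : Matrix (Fin n) (Fin n) ℂ)
    (hK : K.PosSemidef) (hKt : Ktᵀ = Kt) (haug : (augCov K Kt).PosSemidef)
    (Kbar : Matrix (Fin n ⊕ Fin n) (Fin n ⊕ Fin n) ℂ)
    (Hbar : Matrix (Fin m ⊕ Fin m) (Fin n ⊕ Fin n) ℂ)
    (hKbar : Kbar = ((1 : ℂ) / 4) • ((Mmat n)ᴴ * augCov K Kt * Mmat n))
    (hHbar : Hbar = ((Real.sqrt 2 / 2 : ℝ) : ℂ) • ((Mmat m)ᴴ * augChannel H * Mmat n)) :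
    (∀ k : ℕ, Mmat k * (Mmat k)ᴴ = (2 : ℂ) • 1 ∧ (Mmat k)ᴴ * Mmat k = (2 : ℂ) • 1) ∧
    (∀ i j, (Kbar i j).im = 0) ∧ (∀ i j, (Hbar i j).im = 0) ∧
    Kbarᵀ = Kbar ∧ Kbar.PosSemidef ∧ Kbar.trace = K.trace ∧
    (1 + Hbar * Kbar * Hbarᵀ).det = (1 + augChannel H * augCov K Kt * (augChannel H)ᴴ).det := by
  have hKim : ∀ i j, (Kbar i j).im = 0 := fun i j => by
    have h := im_Mmat_conjTranspose_mul_mul K Kt i j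
    rw [hKbar, Matrix.smul_apply, augCov, smul_eq_mul, Complex.mul_im, h]
    simp
  have hHim : ∀ i j, (Hbar i j).im = 0 := fun i j => by
    have h := im_Mmat_conjTranspose_mul_mul H 0 i j
    rw [show mconj (0 : Matrix (Fin m) (Fin n) ℂ) = 0 by ext; simp [mconj]] at h
    rw [hHbar, Matrix.smul_apply, augChannel, smul_eq_mul, Complex.im_ofReal_mul, h, mul_zero]
  have hpsd : Kbar.PosSemidef := by
    rw [hKbar]
    exact (haug.conjTranspose_mul_mul_same (Mmat n)).smul (by positivity)
  refine ⟨fun k => ⟨Mmat_mul_conjTranspose k, Mmat_conjTranspose_mul k⟩, hKim, hHim,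
    (conjTranspose_eq_transpose_of_im_eq_zero hKim).symm.trans hpsd.1, hpsd, ?_, ?_⟩
  · have hc : (mconj K).trace = K.trace := by
      have hT : mconj K = Kᵀ := by
        rw [← congrArg transpose hK.1.eq]
        rfl
      rw [hT, trace_transpose]
    have hK_aug : (augCov K Kt).trace = K.trace + K.trace := by
      rw [← congrArg (K.trace + ·) hc]
      simp [augCov, trace, Fintype.sum_sum_type]
    rw [hKbar, trace_smul, trace_mul_comm, ← Matrix.mul_assoc, Mmat_mul_conjTranspose,
      Matrix.smul_mul, Matrix.one_mul, trace_smul, hK_aug]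
    simp only [smul_eq_mul]
    ring
  · have hs : ((Real.sqrt 2 / 2 : ℝ) : ℂ) * ((Real.sqrt 2 / 2 : ℝ) : ℂ) = 1 / 2 := by
      rw [← Complex.ofReal_mul, div_mul_div_comm, Real.mul_self_sqrt zero_le_two]
      norm_num
    set X := augChannel H * augCov K Kt * (augChannel H)ᴴ with hX
    have key : Hbar * Kbar * Hbarᵀ = ((1 : ℂ) / 2) • ((Mmat m)ᴴ * X * Mmat m) := by
      rw [← conjTranspose_eq_transpose_of_im_eq_zero hHim, hHbar, hKbar]
      generalize hr : ((Real.sqrt 2 / 2 : ℝ) : ℂ) = r at hs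
      have hrs : star r = r := by rw [← hr]; exact Complex.conj_ofReal _
      have hassoc : (Mmat m)ᴴ * augChannel H * Mmat n * ((Mmat n)ᴴ * augCov K Kt * Mmat n) *
          ((Mmat m)ᴴ * augChannel H * Mmat n)ᴴ =
          (Mmat m)ᴴ * augChannel H * (Mmat n * (Mmat n)ᴴ) * augCov K Kt *
            (Mmat n * (Mmat n)ᴴ) * (augChannel H)ᴴ * Mmat m := by
        simp only [conjTranspose_mul, conjTranspose_conjTranspose, Matrix.mul_assoc]
      rw [conjTranspose_smul, hrs]
      simp only [Matrix.smul_mul, Matrix.mul_smul, smul_smul]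
      rw [hassoc, Mmat_mul_conjTranspose]
      simp only [Matrix.smul_mul, Matrix.mul_smul, Matrix.mul_one, smul_smul, hX,
        Matrix.mul_assoc]
      congr 1
      linear_combination hs
    rw [key, Matrix.mul_assoc, ← Matrix.mul_smul, det_one_add_mul_comm, Matrix.smul_mul, Matrix.mul_assoc,
      Mmat_mul_conjTranspose, Matrix.mul_smul, smul_smul, Matrix.mul_one]
    norm_num
end
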